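/- arXiv:2105.14420 — 3 statements merged into one kernel-verified Lean document; each statement's English description precedes it below -/
import Mathlib

section
/- Let λ be a partition of N with at most m parts with λ ≥ μ in the dominance order. Then O_λ ∩ T_μ ∩ n = ⋃_{τ} X̊_τ, the union being over all semistandard Young tableaux τ of shape λ and weight μ. -/
open scoped BigOperators Classical

noncomputable section

namespace Gov

/-- Extend a vector of length `m` by zeros. -/
def ext {m : ℕ} (f : Fin m → ℕ) : ℕ → ℕ := fun r => if h : r < m then f ⟨r, h⟩ else 0

/-- Offset of the `a`-th block: `μ_1 + ⋯ + μ_{a-1}`. -/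
def off {m : ℕ} (μ : Fin m → ℕ) (a : Fin m) : ℕ :=
  ∑ j ∈ Finset.univ.filter (fun j : Fin m => (j : ℕ) < (a : ℕ)), μ j

/-- Total entry access for a square matrix (zero outside the index range). -/
def ent {N : ℕ} (A : Matrix (Fin N) (Fin N) ℂ) (i j : ℕ) : ℂ :=
  if h : i < N ∧ j < N then A ⟨i, h.1⟩ ⟨j, h.2⟩ else 0

/-- Entries of the Jordan matrix `J_μ`:  `J_μ e_a^b = e_a^{b-1}`. -/
def Jent {m : ℕ} (μ : Fin m → ℕ) (i j : ℕ) : ℂ :=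
  if ∃ a : Fin m, ∃ b : ℕ, b + 1 < μ a ∧ i = off μ a + b ∧ j = off μ a + b + 1 then 1 else 0

/-- Membership in the Mirković–Vybornov slice `T_μ`. -/
def inSlice {m N : ℕ} (μ : Fin m → ℕ) (A : Matrix (Fin N) (Fin N) ℂ) : Prop :=
  ∀ s a : Fin m, ∀ t b : ℕ, t < μ s → b < μ a →
    (t + 1 < μ s ∨ (t + 1 = μ s ∧ μ s ≤ b)) →
    ent A (off μ s + t) (off μ a + b) = Jent μ (off μ s + t) (off μ a + b)

/-- Upper triangularity. -/
def upperTri {N : ℕ} (A : Matrix (Fin N) (Fin N) ℂ) : Prop :=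
  ∀ i j : Fin N, (j : ℕ) < (i : ℕ) → A i j = 0

/-- The top-left `d × d` submatrix. -/
def corner {N : ℕ} (A : Matrix (Fin N) (Fin N) ℂ) (d : ℕ) : Matrix (Fin d) (Fin d) ℂ :=
  fun i j => ent A (i : ℕ) (j : ℕ)

/-- `A` is nilpotent with Jordan type `κ` (a partition with at most `rows` parts):
`rank A^k = Σ_r max(κ_r − k, 0)` for all `k ≥ 1`. -/
def hasType {n : ℕ} (A : Matrix (Fin n) (Fin n) ℂ) (rows : ℕ) (κ : ℕ → ℕ) : Prop :=
  ∀ k : ℕ, 1 ≤ k → (A ^ k).rank = ∑ r ∈ Finset.range rows, (κ r - k)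

/-- A semistandard Young tableau of shape `lam` and weight `μ`, both with at most `m` parts,
with entries in `{1, …, m}` (rows and columns are 0-based; `entry r c = 0` outside the shape). -/
structure Tableau (m : ℕ) (lam μ : Fin m → ℕ) where
  entry : ℕ → ℕ → ℕ
  zeros : ∀ r c : ℕ, ¬ c < ext lam r → entry r c = 0
  entry_pos : ∀ r c : ℕ, c < ext lam r → 1 ≤ entry r c
  entry_le : ∀ r c : ℕ, c < ext lam r → entry r c ≤ m
  row_weak : ∀ r c c' : ℕ, c ≤ c' → c' < ext lam r → entry r c ≤ entry r c'
  col_strict : ∀ r r' c : ℕ, r < r' → c < ext lam r' → entry r c < entry r' c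
  weight : ∀ i : Fin m,
    (∑ r ∈ Finset.range m,
      ((Finset.range (ext lam r)).filter fun c => entry r c = (i : ℕ) + 1).card) = μ i

/-- Row lengths of the shape `λ^{(i)}` of the tableau obtained from `T` by deleting all
entries `> i` (here `i` is 1-based). -/
def shapeRow {m : ℕ} {lam μ : Fin m → ℕ} (T : Tableau m lam μ) (i : ℕ) : ℕ → ℕ :=
  fun r => ((Finset.range (ext lam r)).filter fun c => 1 ≤ T.entry r c ∧ T.entry r c ≤ i).card

/-- Row lengths of the shape `λ^{(i,k)}` of the tableau obtained from `T` by deleting all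
entries `> i` and all but the leftmost `k` entries equal to `i` (here `i` is 1-based). -/
def shapeRowBox {m : ℕ} {lam μ : Fin m → ℕ} (T : Tableau m lam μ) (i k : ℕ) : ℕ → ℕ :=
  fun r => ((Finset.range (ext lam r)).filter fun c =>
    (1 ≤ T.entry r c ∧ T.entry r c < i) ∨ (T.entry r c = i ∧
      ((Finset.range c).filter fun c' => ∃ r' < m, T.entry r' c' = i).card < k)).card

/-- The matrix variety `X̊_τ`. -/
def Xcirc {m : ℕ} (μ lam : Fin m → ℕ) (N : ℕ) (T : Tableau m lam μ) :
    Set (Matrix (Fin N) (Fin N) ℂ) :=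
  { A | inSlice μ A ∧ upperTri A ∧
      ∀ i : Fin m, hasType (corner A (off μ i + μ i)) m (shapeRow T ((i : ℕ) + 1)) }

/-- The Zariski topology on `N × N` complex matrices: closed sets are common zero sets of
families of polynomials in the entries. -/
def mzar (N : ℕ) : TopologicalSpace (Matrix (Fin N) (Fin N) ℂ) :=
  TopologicalSpace.generateFrom
    { U | ∃ p : MvPolynomial (Fin N × Fin N) ℂ,
        U = { A | MvPolynomial.eval (fun q => A q.1 q.2) p ≠ 0 } }

/-- Zariski closure. -/
def closureZ {N : ℕ} (S : Set (Matrix (Fin N) (Fin N) ℂ)) : Set (Matrix (Fin N) (Fin N) ℂ) :=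
  letI := mzar N
  closure S

/-- Irreducibility for the Zariski topology. -/
def isIrreducibleZ {N : ℕ} (S : Set (Matrix (Fin N) (Fin N) ℂ)) : Prop :=
  letI := mzar N
  IsIrreducible S

/-- Irreducible components of a subset: maximal irreducible subsets. -/
def irrCompsZ {N : ℕ} (S : Set (Matrix (Fin N) (Fin N) ℂ)) :
    Set (Set (Matrix (Fin N) (Fin N) ℂ)) :=
  { C | C ⊆ S ∧ isIrreducibleZ C ∧
      ∀ C', C' ⊆ S → isIrreducibleZ C' → C ⊆ C' → C' = C }

/-- Dimension of a subset: its Krull dimension as a topological space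
(with the subspace Zariski topology). -/
def dimZ {N : ℕ} (S : Set (Matrix (Fin N) (Fin N) ℂ)) : WithBot ℕ∞ :=
  letI := mzar N
  topologicalKrullDim S

section LinearAlgebra

open Module

variable {K M : Type*} [Field K] [AddCommGroup M] [Module K M] [FiniteDimensional K M]

theorem finrank_map_add_finrank_inf_ker (f : M →ₗ[K] M) (P : Submodule K M) :
    finrank K (P.map f) + finrank K (P ⊓ LinearMap.ker f : Submodule K M) = finrank K P := by
  have h := (f.domRestrict P).finrank_range_add_finrank_ker
  rw [LinearMap.range_domRestrict, LinearMap.ker_domRestrict] at h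
  rw [← h, ← Submodule.map_comap_subtype,
    ← (Submodule.equivMapOfInjective _ P.injective_subtype _).finrank_eq]

theorem finrank_add_finrank_map_le (f : M →ₗ[K] M) {P Q : Submodule K M} (h : P ≤ Q) :
    finrank K P + finrank K (Q.map f) ≤ finrank K Q + finrank K (P.map f) := by
  have hP := finrank_map_add_finrank_inf_ker f P
  have hQ := finrank_map_add_finrank_inf_ker f Q
  have := Submodule.finrank_mono (inf_le_inf_right (LinearMap.ker f) h)
  omega

/-- If `V / W` is generated by one vector modulo the image of `f`, passing from `W` to `V`
increases each `dim (f ^ k · / f ^ (k + 1) ·)` by at most one. -/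
theorem finrank_map_pow_le_of_cyclic (f : End K M) {V W : Submodule K M} (v : M) (hWV : W ≤ V)
    (hW : W.map f ≤ W)
    (hc : V ≤ W ⊔ K ∙ v ⊔ V.map f) (k : ℕ) :
    finrank K (V.map (f ^ k)) + finrank K (W.map (f ^ (k + 1))) ≤
      1 + finrank K (W.map (f ^ k)) + finrank K (V.map (f ^ (k + 1))) := by
  have hpow (P : Submodule K M) : P.map (f ^ (k + 1)) = (P.map f).map (f ^ k) := by
    rw [pow_succ, Module.End.mul_eq_comp, Submodule.map_comp]
  have h1 : V.map (f ^ k) ≤ (W.map (f ^ k) ⊔ V.map (f ^ (k + 1))) ⊔ K ∙ (f ^ k) v := by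
    refine (Submodule.map_mono hc).trans ?_
    rw [Submodule.map_sup, Submodule.map_sup, Submodule.map_span, Set.image_singleton, hpow]
    exact sup_le (sup_le (le_sup_left.trans le_sup_left) le_sup_right)
      (le_sup_right.trans le_sup_left)
  have h2 := Submodule.finrank_mono h1
  have h3 := Submodule.finrank_add_le_finrank_add_finrank
    (W.map (f ^ k) ⊔ V.map (f ^ (k + 1))) (K ∙ (f ^ k) v)
  have h4 := Submodule.finrank_sup_add_finrank_inf_eq (W.map (f ^ k)) (V.map (f ^ (k + 1)))
  have h5 : W.map (f ^ (k + 1)) ≤ W.map (f ^ k) ⊓ V.map (f ^ (k + 1)) := by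
    refine le_inf ?_ (Submodule.map_mono hWV)
    rw [hpow]
    exact Submodule.map_mono hW
  have h6 := Submodule.finrank_mono h5
  have h7 : finrank K (K ∙ (f ^ k) v) ≤ 1 := by
    simpa using finrank_span_le_card (R := K) ({(f ^ k) v} : Set M)
  omega

end LinearAlgebra

section Combinatorics

open Finset

theorem card_filter_range_sub {p : ℕ → Prop} [DecidablePred p]
    (hp : ∀ a b, a ≤ b → p b → p a) (K k : ℕ) :
    ((range K).filter p).card - k = ((Ico k K).filter p).card := by
  by_cases hk : k < K ∧ p k
  · have : (range K).filter p = range k ∪ (Ico k K).filter p := by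
      ext a
      simp only [mem_filter, mem_range, mem_union, mem_Ico]
      constructor
      · intro h
        by_cases hak : a < k
        · exact Or.inl hak
        · exact Or.inr ⟨⟨by omega, h.1⟩, h.2⟩
      · rintro (h | h)
        · exact ⟨by omega, hp a k h.le hk.2⟩
        · exact ⟨h.1.2, h.2⟩
    rw [this, card_union_of_disjoint, card_range, Nat.add_sub_cancel_left]
    rw [disjoint_left]
    intro a
    simp only [mem_filter, mem_range, mem_Ico]
    omega
  · have h1 : (range K).filter p ⊆ range k := by
      intro a
      simp only [mem_filter, mem_range]
      intro h
      by_contra hak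
      exact hk ⟨by omega, hp k a (by omega) h.2⟩
    have h2 : (Ico k K).filter p = ∅ := by
      refine filter_eq_empty_iff.2 fun a ha hpa => ?_
      rw [mem_Ico] at ha
      exact hk ⟨by omega, hp k a ha.1 hpa⟩
    have := card_le_card h1
    rw [card_range] at this
    rw [h2, card_empty]
    omega

/-- Double counting of the boxes of a Young diagram with column lengths `g`. -/
theorem sum_card_filter_lt_sub {g : ℕ → ℕ} (hg : Antitone g) {m : ℕ} (hm : ∀ l, g l ≤ m)
    (K k : ℕ) :
    ∑ r ∈ range m, (((range K).filter fun l => r < g l).card - k) = ∑ l ∈ Ico k K, g l := by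
  have h1 (r : ℕ) : ((range K).filter fun l => r < g l).card - k
      = ((Ico k K).filter fun l => r < g l).card :=
    card_filter_range_sub (fun a b hab (h : r < g b) => h.trans_le (hg hab)) K k
  simp_rw [h1]
  have h2 := sum_card_bipartiteAbove_eq_sum_card_bipartiteBelow
    (s := range m) (t := Ico k K) (fun r l => r < g l)
  simp only [bipartiteAbove, bipartiteBelow] at h2
  rw [h2]
  refine sum_congr rfl fun l _ => ?_
  have : ((range m).filter fun r => r < g l) = range (g l) := by
    ext r
    have := hm l
    simp only [mem_filter, mem_range]
    omega
  rw [this, card_range]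

theorem card_filter_le_succ (s : Finset ℕ) (g : ℕ → ℕ) (i : ℕ) :
    (s.filter fun l => g l ≤ i + 1).card
      = (s.filter fun l => g l ≤ i).card + (s.filter fun l => g l = i + 1).card := by
  rw [← card_union_of_disjoint, ← filter_or]
  · congr 1
    ext l
    rw [mem_filter, mem_filter, Nat.le_succ_iff]
  · rw [disjoint_left]
    intro l
    simp only [mem_filter]
    omega

theorem lt_card_filter_range_iff {p : ℕ → Prop} [DecidablePred p] {m : ℕ}
    (hp : ∀ a b, a ≤ b → p b → p a) (hm : ∀ a, p a → a < m) (r : ℕ) :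
    r < ((range m).filter p).card ↔ p r := by
  constructor
  · intro h
    by_contra hr
    have : (range m).filter p ⊆ range r := by
      intro a ha
      rw [mem_range]
      by_contra! hra
      exact hr (hp r a hra (mem_filter.1 ha).2)
    have := card_le_card this
    rw [card_range] at this
    omega
  · intro h
    have : range (r + 1) ⊆ (range m).filter p := by
      intro a ha
      have := hp a r (Nat.lt_succ_iff.1 (mem_range.1 ha)) h
      exact mem_filter.2 ⟨mem_range.2 (hm a this), this⟩
    have := card_le_card this
    rw [card_range] at this
    omega

theorem sum_Ico_sub_succ_add {g : ℕ → ℕ} (hg : Antitone g) {k K : ℕ} (hk : k ≤ K) :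
    ∑ l ∈ Ico k K, (g l - g (l + 1)) + g K = g k := by
  induction K, hk using Nat.le_induction with
  | base => simp
  | succ K hk ih =>
    rw [sum_Ico_succ_top hk]
    have := hg (Nat.le_add_right K 1)
    omega

/-- A chain of Young diagrams growing by horizontal strips, given by its column lengths `c i`,
is the chain of shapes of a semistandard tableau. -/
theorem exists_tableau_of_column_lengths {m : ℕ} {lam μ : Fin m → ℕ} (K : ℕ)
    (hK : ∀ r, ext lam r ≤ K)
    (c : ℕ → ℕ → ℕ) (h0 : ∀ k, c 0 k = 0) (hmono : ∀ k, Monotone fun i => c i k)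
    (hsucc : ∀ i < m, ∀ k, c (i + 1) k ≤ c i k + 1) (hanti : ∀ i, Antitone (c i))
    (htop : ∀ k r, r < c m k ↔ k < ext lam r)
    (hsum : ∀ i : Fin m, ∑ k ∈ range K, c (i + 1) k = ∑ k ∈ range K, c i k + μ i) :
    ∃ T : Tableau m lam μ, ∀ i ≤ m, ∀ k,
      ∑ r ∈ range m, (shapeRow T i r - k) = ∑ l ∈ Ico k K, c i l := by
  have hcm (i : ℕ) (hi : i ≤ m) (k : ℕ) : c i k ≤ m := by
    by_contra! h
    have := (htop k m).1 (h.trans_le (hmono k hi))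
    simp [ext] at this
  have hex {r k : ℕ} (h : k < ext lam r) : ∃ i, r < c i k := ⟨m, (htop k r).2 h⟩
  let e : ℕ → ℕ → ℕ := fun r k => if h : k < ext lam r then Nat.find (hex h) else 0
  have he {r k : ℕ} (h : k < ext lam r) (i : ℕ) : e r k ≤ i ↔ r < c i k := by
    simp only [e, dif_pos h]
    rw [Nat.find_le_iff]
    exact ⟨fun ⟨j, hj, hr⟩ => hr.trans_le (hmono k hj), fun hr => ⟨i, le_rfl, hr⟩⟩
  have hpos {r k : ℕ} (h : k < ext lam r) : 1 ≤ e r k := by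
    by_contra! h1
    have := (he h 0).1 (by omega)
    rw [h0] at this
    omega
  have hcard (i : ℕ) (hi : i ≤ m) (r : ℕ) :
      ((range (ext lam r)).filter fun k => e r k ≤ i) = (range K).filter fun k => r < c i k := by
    ext k
    simp only [mem_filter, mem_range]
    constructor
    · rintro ⟨h1, h2⟩
      exact ⟨h1.trans_le (hK r), (he h1 i).1 h2⟩
    · rintro ⟨_, h2⟩
      have h1 := (htop k r).1 (h2.trans_le (hmono k hi))
      exact ⟨h1, (he h1 i).2 h2⟩
  have hS (i : ℕ) (hi : i ≤ m) (k : ℕ) :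
      ∑ r ∈ range m, (((range (ext lam r)).filter fun l => e r l ≤ i).card - k)
        = ∑ l ∈ Ico k K, c i l := by
    simp_rw [hcard i hi]
    exact sum_card_filter_lt_sub (hanti i) (hcm i hi) K k
  obtain ⟨T, hT⟩ : ∃ T : Tableau m lam μ, T.entry = e := by
    refine ⟨⟨e, fun r k h => dif_neg h, fun r k h => hpos h, fun r k h => ?_,
      fun r k k' hk h => ?_, fun r r' k hr h => ?_, fun i => ?_⟩, rfl⟩
    · exact (he h m).2 ((htop k r).2 h)
    · exact (he (hk.trans_lt h) _).2 (((he h _).1 le_rfl).trans_le (hanti _ hk))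
    · have h1 : k < ext lam r :=
        (htop k r).1 (hr.trans ((htop k r').2 h))
      have h2 := (he h _).1 le_rfl
      have h3 : e r' k ≤ m := (he h m).2 ((htop k r').2 h)
      have h4 := hpos h
      obtain ⟨j, hj⟩ : ∃ j, e r' k = j + 1 := ⟨e r' k - 1, by omega⟩
      rw [hj] at h2 h3 ⊢
      have h5 := hsucc j (by omega) k
      have h6 := (he h1 j).2 (by omega)
      omega
    · have h1 := hS (i + 1) i.2 0
      have h2 := hS i i.2.le 0
      have h3 := hsum i
      rw [← range_eq_Ico] at h1 h2
      rw [h3, ← h2] at h1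
      simp only [Nat.sub_zero] at h1
      have h4 (r : ℕ) : ((range (ext lam r)).filter fun l => e r l ≤ i + 1).card
          = ((range (ext lam r)).filter fun l => e r l ≤ i).card
            + ((range (ext lam r)).filter fun l => e r l = i + 1).card :=
        card_filter_le_succ _ _ _
      simp_rw [h4, sum_add_distrib] at h1
      omega
  refine ⟨T, fun i hi k => ?_⟩
  rw [← hS i hi k]
  refine sum_congr rfl fun r _ => ?_
  congr 1
  unfold shapeRow
  rw [hT]
  congr 1
  ext l
  simp only [mem_filter, mem_range]
  exact ⟨fun h => ⟨h.1, h.2.2⟩, fun h => ⟨h.1, hpos h.1, h.2⟩⟩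

end Combinatorics

section Matrices

open Module

/-- The span of the first `d` standard basis vectors of `ℂ^N`. -/
def initialSubspace (N d : ℕ) : Submodule ℂ (Fin N → ℂ) where
  carrier := {v | ∀ j : Fin N, d ≤ (j : ℕ) → v j = 0}
  add_mem' := by
    intro a b ha hb j hj
    simp [ha j hj, hb j hj]
  zero_mem' := by
    intro j _
    rfl
  smul_mem' := by
    intro c a ha j hj
    simp [ha j hj]

theorem mem_initialSubspace {N d : ℕ} {v : Fin N → ℂ} :
    v ∈ initialSubspace N d ↔ ∀ j : Fin N, d ≤ (j : ℕ) → v j = 0 :=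
  Iff.rfl

theorem initialSubspace_mono (N : ℕ) : Monotone (initialSubspace N) :=
  fun _ _ h _ hv j hj => hv j (h.trans hj)

theorem initialSubspace_zero (N : ℕ) : initialSubspace N 0 = ⊥ :=
  (Submodule.eq_bot_iff _).2 fun _ hv => funext fun j => hv j (Nat.zero_le _)

theorem single_mem_initialSubspace {N d : ℕ} {j : Fin N} (hj : (j : ℕ) < d) (x : ℂ) :
    (Pi.single j x : Fin N → ℂ) ∈ initialSubspace N d := by
  intro l hl
  rw [Pi.single_eq_of_ne]
  rintro rfl
  omega

/-- Extension of vectors by zeros. -/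
def padZero (N d : ℕ) : (Fin d → ℂ) →ₗ[ℂ] (Fin N → ℂ) where
  toFun x j := if h : (j : ℕ) < d then x ⟨j, h⟩ else 0
  map_add' x y := by
    ext j
    by_cases h : (j : ℕ) < d <;> simp [h]
  map_smul' c x := by
    ext j
    by_cases h : (j : ℕ) < d <;> simp [h]

theorem range_padZero {N d : ℕ} (hd : d ≤ N) :
    LinearMap.range (padZero N d) = initialSubspace N d := by
  ext v
  constructor
  · rintro ⟨x, rfl⟩ j hj
    simp [padZero, hj]
  · intro hv
    refine ⟨fun j => v ⟨j, j.2.trans_le hd⟩, funext fun j => ?_⟩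
    by_cases h : (j : ℕ) < d
    · simp [padZero, h]
    · simp [padZero, h, hv j (not_lt.1 h)]

theorem padZero_injective {N d : ℕ} (hd : d ≤ N) : Function.Injective (padZero N d) := by
  intro x y h
  funext j
  have := congrFun h ⟨j, j.2.trans_le hd⟩
  simpa [padZero] using this

theorem mulVecLin_comp_padZero {N d : ℕ} (hd : d ≤ N) {A : Matrix (Fin N) (Fin N) ℂ}
    (hA : upperTri A) :
    A.mulVecLin ∘ₗ padZero N d = padZero N d ∘ₗ (corner A d).mulVecLin := by
  obtain ⟨e, rfl⟩ := Nat.exists_eq_add_of_le hd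
  refine LinearMap.ext fun x => funext fun j => ?_
  simp only [LinearMap.comp_apply, Matrix.mulVecLin_apply, Matrix.mulVec, dotProduct, padZero,
    LinearMap.coe_mk, AddHom.coe_mk, Fin.sum_univ_add, corner, ent]
  by_cases h : (j : ℕ) < d
  · have h' : (j : ℕ) < d + e := j.2
    have (l : Fin d) : (l : ℕ) < d + e := l.2.trans_le hd
    simp [h, h', this]
    rfl
  · have h0 (l : Fin d) : A j (Fin.castAdd e l) = 0 := hA _ _ (by simp; omega)
    simp [h, h0]

theorem rank_corner_pow {N d : ℕ} (hd : d ≤ N) {A : Matrix (Fin N) (Fin N) ℂ}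
    (hA : upperTri A) (k : ℕ) :
    (corner A d ^ k).rank = finrank ℂ ((initialSubspace N d).map (A.mulVecLin ^ k)) := by
  have h1 := Module.End.commute_pow_left_of_commute (mulVecLin_comp_padZero hd hA) k
  have h2 : (corner A d ^ k).mulVecLin = (corner A d).mulVecLin ^ k :=
    Matrix.toLin'_pow (corner A d) k
  rw [← range_padZero hd, ← LinearMap.range_comp, h1, LinearMap.range_comp,
    ← (Submodule.equivMapOfInjective _ (padZero_injective hd) _).finrank_eq, Matrix.rank, h2]

theorem corner_self {N : ℕ} (A : Matrix (Fin N) (Fin N) ℂ) : corner A N = A := by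
  ext i j
  simp [corner, ent]

theorem map_initialSubspace_le {N : ℕ} {A : Matrix (Fin N) (Fin N) ℂ} (hA : upperTri A) (d : ℕ) :
    (initialSubspace N d).map A.mulVecLin ≤ initialSubspace N d := by
  rintro _ ⟨v, hv, rfl⟩ j hj
  rw [Matrix.mulVecLin_apply, Matrix.mulVec, dotProduct]
  refine Finset.sum_eq_zero fun l _ => ?_
  by_cases hl : (l : ℕ) < d
  · rw [hA j l (hl.trans_le hj), zero_mul]
  · rw [hv l (not_lt.1 hl), mul_zero]

theorem diag_eq_zero_of_isNilpotent {N : ℕ} {A : Matrix (Fin N) (Fin N) ℂ} (hA : upperTri A)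
    (hn : IsNilpotent A) (j : Fin N) : A j j = 0 := by
  have h1 := Matrix.charpoly_of_isUpperTriangular A (fun i j h => hA i j h)
  have h2 := (Matrix.isNilpotent_charpoly_sub_pow_of_isNilpotent hn).eq_zero
  have h3 : A.charpoly.eval (A j j) = 0 := by
    rw [h1, Polynomial.eval_prod]
    exact Finset.prod_eq_zero (Finset.mem_univ j) (by simp)
  rw [sub_eq_zero.1 h2, Polynomial.eval_pow, Polynomial.eval_X] at h3
  exact eq_zero_of_pow_eq_zero h3

theorem off_eq_sum_range {m : ℕ} (μ : Fin m → ℕ) (a : Fin m) :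
    off μ a = ∑ j ∈ Finset.range a, ext μ j := by
  have h1 (j : Fin m) : (if (j : ℕ) < a then μ j else 0) = if (j : ℕ) < a then ext μ j else 0 := by
    simp [ext]
  rw [off, Finset.sum_filter, Finset.sum_congr rfl fun j _ => h1 j,
    Fin.sum_univ_eq_sum_range (fun j => if j < (a : ℕ) then ext μ j else 0) m,
    ← Finset.sum_filter]
  congr 1
  ext j
  simp only [Finset.mem_filter, Finset.mem_range]
  omega

theorem off_add_eq_sum_range {m : ℕ} (μ : Fin m → ℕ) (a : Fin m) :
    off μ a + μ a = ∑ j ∈ Finset.range (a + 1), ext μ j := by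
  rw [Finset.sum_range_succ, off_eq_sum_range]
  simp [ext]

theorem sum_range_ext {m : ℕ} (μ : Fin m → ℕ) :
    ∑ j ∈ Finset.range m, ext μ j = ∑ j, μ j := by
  rw [← Fin.sum_univ_eq_sum_range]
  simp [ext]

/-- On each block of the slice, a nilpotent upper-triangular matrix acts as a single Jordan block,
so that the block is generated by its last basis vector. -/
theorem exists_initialSubspace_le {m N : ℕ} {μ : Fin m → ℕ} {A : Matrix (Fin N) (Fin N) ℂ}
    (hS : inSlice μ A) (hA : upperTri A) (hd : ∀ j, A j j = 0) (i : Fin m)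
    (hi : off μ i + μ i ≤ N) :
    ∃ v, initialSubspace N (off μ i + μ i) ≤ initialSubspace N (off μ i) ⊔ ℂ ∙ v ⊔
      (initialSubspace N (off μ i + μ i)).map A.mulVecLin := by
  refine ⟨fun l => if (l : ℕ) + 1 = off μ i + μ i then 1 else 0, fun x hx => ?_⟩
  rw [pi_eq_sum_univ' x]
  refine Submodule.sum_mem _ fun j _ => ?_
  by_cases h1 : off μ i + μ i ≤ (j : ℕ)
  · simp [hx j h1]
  refine Submodule.smul_mem _ _ ?_
  by_cases h2 : (j : ℕ) < off μ i
  · refine Submodule.mem_sup_left (Submodule.mem_sup_left ?_)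
    exact single_mem_initialSubspace h2 1
  by_cases h3 : (j : ℕ) + 1 = off μ i + μ i
  · refine Submodule.mem_sup_left (Submodule.mem_sup_right ?_)
    convert Submodule.mem_span_singleton_self _ using 3 with l
    rw [Pi.single_apply]
    refine if_congr ?_ rfl rfl
    rw [Fin.ext_iff]
    omega
  let j' : Fin N := ⟨j + 1, by omega⟩
  have h4 : A.mulVecLin (Pi.single j' 1) ∈ (initialSubspace N (off μ i + μ i)).map A.mulVecLin :=
    Submodule.mem_map_of_mem (single_mem_initialSubspace (show (j : ℕ) + 1 < _ by omega) 1)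
  have h5 : A.mulVecLin (Pi.single j' 1) - Pi.single j 1 ∈ initialSubspace N (off μ i) := by
    intro l hl
    rw [Matrix.mulVecLin_apply, Matrix.mulVec_single_one, Pi.sub_apply, Matrix.col_apply,
      sub_eq_zero]
    rcases lt_trichotomy (l : ℕ) (j + 1) with h | h | h
    · have h6 := hS i i (l - off μ i) (j + 1 - off μ i) (by omega) (by omega)
        (Or.inl (by omega))
      rw [Nat.add_sub_cancel' hl, Nat.add_sub_cancel' (by omega), ent, dif_pos ⟨l.2, j'.2⟩] at h6
      refine h6.trans ?_
      rw [Jent, Pi.single_apply]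
      refine if_congr ⟨?_, ?_⟩ rfl rfl
      · rintro ⟨a, b, _, h7, h8⟩
        exact Fin.ext (by omega)
      · rintro rfl
        exact ⟨i, l - off μ i, by omega, by omega, by omega⟩
    · have : l = j' := Fin.ext h
      rw [this, hd, Pi.single_eq_of_ne]
      intro h6
      have := congrArg Fin.val h6
      simp [j'] at this
    · rw [hA l j' h, Pi.single_eq_of_ne]
      rintro rfl
      omega
  rw [← sub_sub_cancel (A.mulVecLin (Pi.single j' 1)) (Pi.single j 1)]
  exact Submodule.sub_mem _ (Submodule.mem_sup_right h4)
    (Submodule.mem_sup_left (Submodule.mem_sup_left h5))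

end Matrices


/-- The corners of a nilpotent upper-triangular element of the slice have the shapes of a
semistandard tableau as Jordan types. -/
theorem exists_mem_Xcirc {m N : ℕ} {μ lam : Fin m → ℕ} (hN : N = ∑ j, μ j)
    (hlammono : ∀ i j : Fin m, i ≤ j → lam j ≤ lam i) (hlamsum : ∑ j, lam j = N)
    {A : Matrix (Fin N) (Fin N) ℂ} (hT : hasType A m (ext lam)) (hS : inSlice μ A)
    (hA : upperTri A) : ∃ T : Tableau m lam μ, A ∈ Xcirc μ lam N T := by
  let D : ℕ → ℕ := fun i => ∑ j ∈ Finset.range i, ext μ j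
  let f := A.mulVecLin
  let r : ℕ → ℕ → ℕ := fun i k => Module.finrank ℂ ((initialSubspace N (D i)).map (f ^ k))
  have hDm : D m = N := (sum_range_ext μ).trans hN.symm
  have hDmono : Monotone D := fun i j hij =>
    Finset.sum_le_sum_of_subset (Finset.range_mono hij)
  have hDle {i : ℕ} (hi : i ≤ m) : D i ≤ N := hDm ▸ hDmono hi
  have hmap (i k : ℕ) : (initialSubspace N (D i)).map (f ^ (k + 1))
      = ((initialSubspace N (D i)).map (f ^ k)).map f := by
    rw [pow_succ', Module.End.mul_eq_comp, Submodule.map_comp]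
  have hrank {i : ℕ} (hi : i ≤ m) (k : ℕ) : (corner A (D i) ^ k).rank = r i k :=
    rank_corner_pow (hDle hi) hA k
  have hr0 {i : ℕ} (hi : i ≤ m) : r i 0 = D i := by
    rw [← hrank hi, pow_zero, Matrix.rank_one, Fintype.card_fin]
  have hrm (k : ℕ) : r m k = ∑ l ∈ Finset.range m, (ext lam l - k) := by
    rcases Nat.eq_zero_or_pos k with rfl | hk
    · rw [hr0 le_rfl, hDm, ← hlamsum, ← sum_range_ext]
      rfl
    · rw [← hT k hk, ← hrank le_rfl, hDm, corner_self]
  have hlamle (l : ℕ) : ext lam l ≤ N := by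
    by_cases hl : l < m
    · rw [ext, dif_pos hl, ← hlamsum]
      exact Finset.single_le_sum (fun _ _ => Nat.zero_le _) (Finset.mem_univ _)
    · simp [ext, hl]
  have hlamanti : Antitone (ext lam) := by
    intro a b hab
    by_cases hb : b < m
    · rw [ext, ext, dif_pos hb, dif_pos (hab.trans_lt hb)]
      exact hlammono _ _ hab
    · simp [ext, hb]
  have hranti (i : ℕ) : Antitone (r i) := by
    refine antitone_nat_of_succ_le fun k => ?_
    have h := Submodule.finrank_map_le f ((initialSubspace N (D i)).map (f ^ k))
    rwa [← hmap] at h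
  have hrmono (k : ℕ) : Monotone fun i => r i k := fun i j hij =>
    Submodule.finrank_mono (Submodule.map_mono (initialSubspace_mono N (hDmono hij)))
  have hrN {i : ℕ} (hi : i ≤ m) {k : ℕ} (hk : N ≤ k) : r i k = 0 := by
    have h1 : r m k = 0 := by
      rw [hrm]
      exact Finset.sum_eq_zero fun l _ => Nat.sub_eq_zero_of_le ((hlamle l).trans hk)
    exact Nat.le_zero.1 ((hrmono k hi).trans h1.le)
  have hnil : IsNilpotent A := by
    refine ⟨N + 1, ?_⟩
    have h1 := (hT (N + 1) (by omega)).trans (hrm (N + 1)).symm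
    rw [hrN le_rfl (by omega)] at h1
    rw [Matrix.rank, Submodule.finrank_eq_zero, LinearMap.range_eq_bot] at h1
    exact Matrix.toLin'.map_eq_zero_iff.1 h1
  have hdiag := diag_eq_zero_of_isNilpotent hA hnil
  let c : ℕ → ℕ → ℕ := fun i k => r i k - r i (k + 1)
  have hc0 (k : ℕ) : c 0 k = 0 := by
    have hD0 : D 0 = 0 := Finset.sum_range_zero _
    have hr : r 0 k = 0 := by
      simp only [r]
      rw [hD0, initialSubspace_zero, Submodule.map_bot, finrank_bot]
    change r 0 k - r 0 (k + 1) = 0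
    rw [hr, Nat.zero_sub]
  have hcmono (k : ℕ) : Monotone fun i => c i k := by
    intro i j hij
    have h1 := finrank_add_finrank_map_le f
      (Submodule.map_mono (f := f ^ k) (initialSubspace_mono N (hDmono hij)))
    rw [← hmap, ← hmap] at h1
    have h2 : r i k + r j (k + 1) ≤ r j k + r i (k + 1) := h1
    have h3 := hranti i (Nat.le_add_right k 1)
    change r i k - r i (k + 1) ≤ r j k - r j (k + 1)
    omega
  have hcsucc {i : ℕ} (hi : i < m) (k : ℕ) : c (i + 1) k ≤ c i k + 1 := by
    have h0 : off μ ⟨i, hi⟩ = D i := off_eq_sum_range μ ⟨i, hi⟩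
    have h1 : off μ ⟨i, hi⟩ + μ ⟨i, hi⟩ = D (i + 1) := off_add_eq_sum_range μ ⟨i, hi⟩
    obtain ⟨v, hv⟩ := exists_initialSubspace_le hS hA hdiag ⟨i, hi⟩ (h1 ▸ hDle hi)
    rw [h1, h0] at hv
    have h2 : r (i + 1) k + r i (k + 1) ≤ 1 + r i k + r (i + 1) (k + 1) :=
      finrank_map_pow_le_of_cyclic f v (initialSubspace_mono N (hDmono (Nat.le_succ i)))
        (map_initialSubspace_le hA _) hv k
    have h3 := hranti i (Nat.le_add_right k 1)
    change r (i + 1) k - r (i + 1) (k + 1) ≤ r i k - r i (k + 1) + 1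
    omega
  have hcanti (i : ℕ) : Antitone (c i) := by
    refine antitone_nat_of_succ_le fun k => ?_
    have h1 := finrank_add_finrank_map_le f
      (show (initialSubspace N (D i)).map (f ^ (k + 1)) ≤ (initialSubspace N (D i)).map (f ^ k) by
        rw [pow_succ, Module.End.mul_eq_comp, Submodule.map_comp]
        exact Submodule.map_mono (map_initialSubspace_le hA _))
    rw [← hmap, ← hmap] at h1
    have h2 : r i (k + 1) + r i (k + 1) ≤ r i k + r i (k + 1 + 1) := h1
    change r i (k + 1) - r i (k + 1 + 1) ≤ r i k - r i (k + 1)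
    omega
  have hctop (k l : ℕ) : l < c m k ↔ k < ext lam l := by
    have h1 : r m k - r m (k + 1)
        = ((Finset.range m).filter fun l => k < ext lam l).card := by
      rw [hrm, hrm, Finset.card_filter, Nat.sub_eq_iff_eq_add, ← Finset.sum_add_distrib]
      · refine Finset.sum_congr rfl fun l _ => ?_
        split_ifs <;> omega
      · exact Finset.sum_le_sum fun l _ => by omega
    change l < r m k - r m (k + 1) ↔ _
    rw [h1]
    refine lt_card_filter_range_iff (fun a b hab h => h.trans_le (hlamanti hab)) (fun a ha => ?_) l
    by_contra hm
    simp [ext, hm] at ha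
  have hcsum (i : Fin m) :
      ∑ k ∈ Finset.range N, c (i + 1) k = ∑ k ∈ Finset.range N, c i k + μ i := by
    have h1 {i : ℕ} (hi : i ≤ m) :
        ∑ k ∈ Finset.range N, (r i k - r i (k + 1)) = D i := by
      have := sum_Ico_sub_succ_add (hranti i) (Nat.zero_le N)
      rwa [hrN hi le_rfl, hr0 hi, Nat.Ico_zero_eq_range] at this
    have hi : (i : ℕ) + 1 ≤ m := i.2
    rw [h1 hi, h1 i.2.le]
    exact (off_add_eq_sum_range μ i).symm.trans (by rw [off_eq_sum_range])
  obtain ⟨T, hTab⟩ := exists_tableau_of_column_lengths N hlamle c hc0 hcmono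
    (fun _ hi => hcsucc hi) hcanti hctop hcsum
  refine ⟨T, hS, hA, fun i k _ => ?_⟩
  have hi : (i : ℕ) + 1 ≤ m := i.2
  rw [off_add_eq_sum_range, hTab _ hi k]
  refine (hrank hi k).trans ?_
  rcases le_or_gt k N with hk | hk
  · have := sum_Ico_sub_succ_add (hranti (i + 1)) hk
    rw [hrN hi le_rfl] at this
    exact this.symm
  · rw [hrN hi hk.le, Finset.Ico_eq_empty (by omega), Finset.sum_empty]

theorem shapeRow_top {m : ℕ} {lam μ : Fin m → ℕ} (T : Tableau m lam μ) :
    shapeRow T m = ext lam := by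
  funext r
  rw [shapeRow, Finset.filter_true_of_mem, Finset.card_range]
  intro c hc
  rw [Finset.mem_range] at hc
  exact ⟨T.entry_pos r c hc, T.entry_le r c hc⟩

theorem hasType_of_mem_Xcirc {m N : ℕ} (hm : 1 ≤ m) {μ lam : Fin m → ℕ} (hN : N = ∑ j, μ j)
    {T : Tableau m lam μ} {A : Matrix (Fin N) (Fin N) ℂ} (hA : A ∈ Xcirc μ lam N T) :
    hasType A m (ext lam) := by
  obtain ⟨m, rfl⟩ := Nat.exists_eq_add_of_le' hm
  have h := hA.2.2 (Fin.last m)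
  rw [off_add_eq_sum_range, Fin.val_last] at h
  rwa [sum_range_ext, ← hN, corner_self, shapeRow_top] at h

/-- `O_λ ∩ T_μ ∩ n = ⋃_τ X̊_τ`, the union over all semistandard Young
tableaux of shape `λ` and weight `μ`. -/
theorem stmt2 (m : ℕ) (hm : 1 ≤ m) (μ : Fin m → ℕ)
    (hμmono : ∀ i j : Fin m, i ≤ j → μ j ≤ μ i) (hμpos : ∀ i : Fin m, 1 ≤ μ i)
    (N : ℕ) (hN : N = ∑ j, μ j)
    (lam : Fin m → ℕ) (hlammono : ∀ i j : Fin m, i ≤ j → lam j ≤ lam i)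
    (hlamsum : ∑ j, lam j = N)
    (hdom : ∀ k : ℕ, ∑ j ∈ Finset.range k, ext μ j ≤ ∑ j ∈ Finset.range k, ext lam j) :
    {A : Matrix (Fin N) (Fin N) ℂ | hasType A m (ext lam) ∧ inSlice μ A ∧ upperTri A}
      = ⋃ T : Tableau m lam μ, Xcirc μ lam N T := by
  ext A
  rw [Set.mem_iUnion]
  constructor
  · rintro ⟨hT, hS, hA⟩
    exact exists_mem_Xcirc hN hlammono hlamsum hT hS hA
  · rintro ⟨T, hA⟩
    exact ⟨hasType_of_mem_Xcirc hm hN hA, hA.1, hA.2.1⟩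

end Gov
end
end

section
/- Let N ≥ 2, let C be an (N−2)×(N−2) complex matrix, and let v, w ∈ ℂ^{N−2} be column vectors. Let B be the (N−1)×(N−1) matrix with block form [[C, v],[0, 0]] (top-left block C, last column v above a final zero row), and let A be the N×N matrix with block form [[C, v, w],[0, 0, 1],[0, 0, 0]] (top-left block C, columns N−1 and N having top parts v and w respectively, the (N−1, N) entry equal to 1, and all other entries of the last two rows equal to 0). Then for every integer p ≥ 2: if rank(C^p) < rank(B^p), then rank(B^p) < rank(A^p). -/
open Module in
/-- Let `c`, `b`, `a` be endomorphisms intertwined by injections `i`, `j`, such that the range of `b`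
lies in that of `i`, which together with a vector `e` spans `V`. If a vector `f` is sent by `a` to
`j (i w + e)`, then a strict growth of rank from `c ^ p` to `b ^ p` forces one from `b ^ p` to
`a ^ p`. -/
lemma finrank_range_pow_lt_of_intertwining {K U V W : Type*} [Field K]
    [AddCommGroup U] [Module K U] [AddCommGroup V] [Module K V] [AddCommGroup W] [Module K W]
    [FiniteDimensional K U] [FiniteDimensional K W]
    (c : End K U) (b : End K V) (a : End K W) (i : U →ₗ[K] V) (j : V →ₗ[K] W)
    (hi : Function.Injective i) (hj : Function.Injective j)
    (hbi : ∀ x, b (i x) = i (c x)) (haj : ∀ y, a (j y) = j (b y))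
    (hb : ∀ y, ∃ x, b y = i x) (e : V) (he : ∀ y, ∃ x, ∃ t : K, y = i x + t • e)
    (w : U) (f : W) (hf : a f = j (i w + e)) {p : ℕ} (hp : p ≠ 0)
    (h : finrank K (LinearMap.range (c ^ p)) < finrank K (LinearMap.range (b ^ p))) :
    finrank K (LinearMap.range (b ^ p)) < finrank K (LinearMap.range (a ^ p)) := by
  have hbi' (k : ℕ) (x : U) : (b ^ k) (i x) = i ((c ^ k) x) := by
    induction k with
    | zero => simp
    | succ k ih => simp [pow_succ', ih, hbi]
  have haj' (k : ℕ) (y : V) : (a ^ k) (j y) = j ((b ^ k) y) := by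
    induction k with
    | zero => simp
    | succ k ih => simp [pow_succ', ih, haj]
  have hle : (LinearMap.range (b ^ p)).map j ≤ LinearMap.range (a ^ p) := by
    rintro _ ⟨_, ⟨y, rfl⟩, rfl⟩
    exact ⟨j y, haj' p y⟩
  rw [(Submodule.equivMapOfInjective j hj (LinearMap.range (b ^ p))).finrank_eq]
  refine Submodule.finrank_lt_finrank_of_lt (lt_of_le_of_ne hle fun heq => h.not_ge ?_)
  have hmem : (a ^ p) f ∈ (LinearMap.range (b ^ p)).map j := heq ▸ ⟨f, rfl⟩
  obtain ⟨_, ⟨y, rfl⟩, hy⟩ := hmem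
  obtain ⟨q, rfl⟩ := Nat.exists_eq_succ_of_ne_zero hp
  have hq : (b ^ (q + 1)) y = (b ^ q) (i w + e) := hj <| by
    rw [← haj' q, ← hf, hy, pow_succ, Module.End.mul_apply]
  obtain ⟨z, hz⟩ := hb y
  have hbe : (b ^ (q + 1)) e = i ((c ^ (q + 1)) (z - w)) := by
    have h1 := congrArg b hq
    rw [← Module.End.mul_apply, ← Module.End.mul_apply, ← pow_succ', ← pow_succ', pow_succ,
      Module.End.mul_apply, hz, map_add, hbi', hbi'] at h1
    rw [map_sub, map_sub, h1, add_sub_cancel_left]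
  rw [(Submodule.equivMapOfInjective i hi (LinearMap.range (c ^ (q + 1)))).finrank_eq]
  refine Submodule.finrank_mono ?_
  rintro _ ⟨y, rfl⟩
  obtain ⟨x, t, rfl⟩ := he y
  exact ⟨_, ⟨x + t • (z - w), rfl⟩, by simp only [map_add, map_smul, hbi', hbe]⟩

/-- Extension of a vector by a final zero coordinate. -/
def snocZero (K : Type*) [Semiring K] (n : ℕ) : (Fin n → K) →ₗ[K] (Fin (n + 1) → K) where
  toFun x := Fin.snoc (α := fun _ => K) x 0
  map_add' x y := by
    ext k
    refine Fin.lastCases ?_ (fun k => ?_) k <;> simp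
  map_smul' r x := by
    ext k
    refine Fin.lastCases ?_ (fun k => ?_) k <;> simp

@[simp]
lemma snocZero_castSucc {K : Type*} [Semiring K] {n : ℕ} (x : Fin n → K) (k : Fin n) :
    snocZero K n x k.castSucc = x k := by
  simp [snocZero]

@[simp]
lemma snocZero_last {K : Type*} [Semiring K] {n : ℕ} (x : Fin n → K) :
    snocZero K n x (Fin.last n) = 0 := by
  simp [snocZero]

lemma snocZero_injective (K : Type*) [Semiring K] (n : ℕ) :
    Function.Injective (snocZero K n) := fun x y hxy => by
  ext k
  simpa using congrFun hxy k.castSucc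


/-- Let `B = [[C, v], [0, 0]]` be an `(N−1) × (N−1)` matrix and let
`A = [[C, v, w], [0, 0, 1], [0, 0, 0]]` be the `N × N` matrix extending it. Then for every
`p ≥ 2`, if `rank(C^p) < rank(B^p)` then `rank(B^p) < rank(A^p)`. -/
theorem stmt5 (N : ℕ) (hN : 2 ≤ N)
    (C : Matrix (Fin (N - 2)) (Fin (N - 2)) ℂ)
    (v w : Fin (N - 2) → ℂ)
    (B : Matrix (Fin (N - 1)) (Fin (N - 1)) ℂ)
    (hB : B = fun (i j : Fin (N - 1)) =>
      if hi : (i : ℕ) < N - 2 then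
        if hj : (j : ℕ) < N - 2 then C ⟨(i : ℕ), hi⟩ ⟨(j : ℕ), hj⟩
        else v ⟨(i : ℕ), hi⟩
      else 0)
    (A : Matrix (Fin N) (Fin N) ℂ)
    (hA : A = fun (i j : Fin N) =>
      if hi : (i : ℕ) < N - 2 then
        if hj : (j : ℕ) < N - 2 then C ⟨(i : ℕ), hi⟩ ⟨(j : ℕ), hj⟩
        else if (j : ℕ) = N - 2 then v ⟨(i : ℕ), hi⟩
        else w ⟨(i : ℕ), hi⟩
      else if (i : ℕ) = N - 2 ∧ (j : ℕ) = N - 1 then 1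
      else 0)
    (p : ℕ) (hp : 2 ≤ p)
    (h : (C ^ p).rank < (B ^ p).rank) :
    (B ^ p).rank < (A ^ p).rank := by
  obtain ⟨n, rfl⟩ := Nat.exists_eq_add_of_le' hN
  change Matrix (Fin n) (Fin n) ℂ at C
  change Matrix (Fin (n + 1)) (Fin (n + 1)) ℂ at B
  change Fin n → ℂ at v w
  have hrank {m : ℕ} (M : Matrix (Fin m) (Fin m) ℂ) :
      (M ^ p).rank = Module.finrank ℂ (LinearMap.range (Matrix.toLin' M ^ p)) := by
    rw [← Matrix.toLin'_pow]
    rfl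
  have hB₁ (i j : Fin n) : B i.castSucc j.castSucc = C i j := by
    simp [hB]
  have hB₂ (i : Fin n) : B i.castSucc (Fin.last n) = v i := by
    simp [hB]
  have hB₃ (j : Fin (n + 1)) : B (Fin.last n) j = 0 := by
    simp [hB]
  have hA₁ (i j : Fin (n + 1)) : A i.castSucc j.castSucc = B i j := by
    have hj := j.isLt
    simp only [hA, hB]
    grind
  have hA₂ (i : Fin n) : A i.castSucc.castSucc (Fin.last (n + 1)) = w i := by
    simp [hA]
  have hA₃ : A (Fin.last n).castSucc (Fin.last (n + 1)) = 1 := by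
    simp [hA]
  have hA₄ (j : Fin (n + 2)) : A (Fin.last (n + 1)) j = 0 := by
    simp [hA]
  have hBlast (y : Fin (n + 1) → ℂ) : (B.mulVec y) (Fin.last n) = 0 := by
    simp [Matrix.mulVec, dotProduct, hB₃]
  erw [hrank C, hrank B] at h
  erw [hrank B, hrank A]
  refine finrank_range_pow_lt_of_intertwining (Matrix.toLin' C) (Matrix.toLin' B)
    (Matrix.toLin' A) (snocZero ℂ n) (snocZero ℂ (n + 1)) (snocZero_injective ℂ n)
    (snocZero_injective ℂ (n + 1)) (fun x => ?_) (fun y => ?_) (fun y => ?_)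
    (Pi.single (Fin.last n) 1) (fun y => ?_) w (Pi.single (Fin.last (n + 1)) 1) ?_ (by lia) h
  · ext k
    refine Fin.lastCases ?_ (fun k => ?_) k
    · simp [hBlast]
    · simp [Matrix.mulVec, dotProduct, Fin.sum_univ_castSucc, hB₁]
  · ext k
    refine Fin.lastCases ?_ (fun k => ?_) k
    · simp [Matrix.mulVec, dotProduct, hA₄]
    · simp [Matrix.mulVec, dotProduct, Fin.sum_univ_castSucc (n := n + 1), hA₁]
  · refine ⟨fun k => B.mulVec y k.castSucc, ?_⟩
    ext k
    refine Fin.lastCases ?_ (fun k => ?_) k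
    · simp [hBlast]
    · simp
  · refine ⟨fun k => y k.castSucc, y (Fin.last n), ?_⟩
    ext k
    refine Fin.lastCases ?_ (fun k => ?_) k <;> simp
  · ext k
    refine Fin.lastCases ?_ (fun k => ?_) k
    · simp [hA₄]
    · refine Fin.lastCases ?_ (fun k => ?_) k
      · simp [hA₃]
      · simp [hA₂]
end

section
/- Let τ be a semistandard Young tableau of shape λ and weight μ, let B ∈ X̊_{τ−[m]}, and let S = (B^{λ_r−1})^{-1}(Im B^{λ_r}) = { v ∈ ℂ^{N−1} : B^{λ_r−1} v ∈ Im(B^{λ_r}) }. Then ℂ^{N−1} = S + L. -/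
open scoped BigOperators Classical

noncomputable section

namespace Gov

/-- `X̊_{τ−[m]}`: the matrix variety of the tableau obtained from `τ` by deleting its
rightmost entry equal to `m`, defined inside `(N−1) × (N−1)` matrices with respect to the
weight `μ' = (μ_1, …, μ_{m−1}, μ_m − 1)`. -/
def XcircMinus {m : ℕ} (μ lam : Fin m → ℕ) (N : ℕ) (T : Tableau m lam μ)
    (last : Fin m) : Set (Matrix (Fin (N - 1)) (Fin (N - 1)) ℂ) :=
  { B | inSlice (Function.update μ last (μ last - 1)) B ∧ upperTri B ∧
      ∀ i : Fin m,
        hasType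
          (corner B (off (Function.update μ last (μ last - 1)) i
            + Function.update μ last (μ last - 1) i)) m
          (if (i : ℕ) + 1 = m then shapeRowBox T m (μ last - 1)
           else shapeRow T ((i : ℕ) + 1)) }

/-- The standard basis vector of `ℂ^n` supported at (0-based) position `i`. -/
def stdVec (n : ℕ) (i : ℕ) : Fin n → ℂ := fun j => if (j : ℕ) = i then 1 else 0

/-- `L = span(e_1^{μ_1}, …, e_{m−1}^{μ_{m−1}})`. -/
def Lspan {m : ℕ} (μ : Fin m → ℕ) (n : ℕ) : Submodule ℂ (Fin n → ℂ) :=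
  Submodule.span ℂ
    { v | ∃ a : Fin m, (a : ℕ) + 1 < m ∧ v = stdVec n (off μ a + (μ a - 1)) }

/-- `S = (B^{l−1})^{-1}(Im B^{l})`. -/
def Ssub {n : ℕ} (B : Matrix (Fin n) (Fin n) ℂ) (l : ℕ) : Submodule ℂ (Fin n → ℂ) :=
  Submodule.comap (Matrix.mulVecLin (B ^ (l - 1)))
    (LinearMap.range (Matrix.mulVecLin (B ^ l)))

theorem shapeRow_tsub_eq_shapeRowBox_tsub {m : ℕ} {lam μ : Fin m → ℕ} (T : Tableau m lam μ) (k R : ℕ)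
    (hrow : shapeRowBox T m k R + 1 = ext lam R)
    (hother : ∀ s, s ≠ R → shapeRowBox T m k s = ext lam s) :
    k < ext lam R ∧ ∀ s, shapeRow T (m - 1) s - (ext lam R - 1)
      = shapeRowBox T m k s - (ext lam R - 1) := by
  have hRm : R < m := by
    by_contra h
    simp [ext, h] at hrow
  obtain ⟨c₀, hc₀, hm₀, hk₀⟩ : ∃ c₀ < ext lam R, T.entry R c₀ = m ∧
      k ≤ ((Finset.range c₀).filter fun c' => ∃ r' < m, T.entry r' c' = m).card := by
    by_contra! h
    have hall : shapeRowBox T m k R = ext lam R := by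
      unfold shapeRowBox
      rw [Finset.filter_true_of_mem, Finset.card_range]
      intro c hc
      rw [Finset.mem_range] at hc
      have h1 := T.entry_pos R c hc
      have h2 := T.entry_le R c hc
      by_cases he : T.entry R c = m
      · exact Or.inr ⟨he, h c hc he⟩
      · exact Or.inl ⟨h1, by omega⟩
    omega
  have hkc : k ≤ c₀ := hk₀.trans ((Finset.card_filter_le _ _).trans_eq (Finset.card_range _))
  have hlast : T.entry R (ext lam R - 1) = m :=
    le_antisymm (T.entry_le _ _ (by omega))
      (hm₀.ge.trans (T.row_weak R c₀ (ext lam R - 1) (by omega) (by omega)))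
  have hle : ∀ s, shapeRow T (m - 1) s ≤ shapeRowBox T m k s := fun s =>
    Finset.card_le_card (Finset.monotone_filter_right _ fun c _ h => Or.inl ⟨h.1, by omega⟩)
  refine ⟨by omega, fun s => ?_⟩
  rcases lt_trichotomy s R with hs | rfl | hs
  · congr 1
    rw [hother s hs.ne]
    have hfull : ∀ c < ext lam s, (1 ≤ T.entry s c ∧ T.entry s c < m) ∨ (T.entry s c = m ∧
        ((Finset.range c).filter fun c' => ∃ r' < m, T.entry r' c' = m).card < k) := by
      have := hother s hs.ne
      unfold shapeRowBox at this
      intro c hc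
      have h2 := Finset.card_filter_eq_iff.1 (this.trans (Finset.card_range _).symm)
      exact h2 c (Finset.mem_range.2 hc)
    unfold shapeRow
    rw [Finset.filter_true_of_mem, Finset.card_range]
    intro c hc
    rw [Finset.mem_range] at hc
    rcases hfull c hc with h | ⟨h, hk⟩
    · exact ⟨h.1, by omega⟩
    · exfalso
      have hcc : c₀ ≤ c := by
        by_contra hlt
        have h3 := T.col_strict s R c hs (by omega)
        have h4 := T.entry_le R c (by omega)
        omega
      have h5 : ((Finset.range c₀).filter fun c' => ∃ r' < m, T.entry r' c' = m).card ≤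
          ((Finset.range c).filter fun c' => ∃ r' < m, T.entry r' c' = m).card :=
        Finset.card_le_card (Finset.filter_subset_filter _ (Finset.range_mono hcc))
      omega
  · have := hle s
    omega
  · have h1 := hle s
    rw [hother s hs.ne'] at h1 ⊢
    have h2 : ext lam s ≤ ext lam R - 1 := by
      by_contra hlt
      have h3 := T.col_strict R s (ext lam R - 1) hs (by omega)
      have h4 := T.entry_le s (ext lam R - 1) (by omega)
      omega
    omega

theorem sum_filter_lt_succ {m : ℕ} (μ : Fin m → ℕ) (a : Fin m) :
    ∑ j ∈ Finset.univ.filter (fun j : Fin m => (j : ℕ) < (a : ℕ) + 1), μ j = off μ a + μ a := by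
  have : Finset.univ.filter (fun j : Fin m => (j : ℕ) < (a : ℕ) + 1)
      = insert a (Finset.univ.filter (fun j : Fin m => (j : ℕ) < (a : ℕ))) := by
    ext j
    simp [Fin.ext_iff]
    omega
  rw [this, Finset.sum_insert (by simp), off, add_comm]

theorem exists_block_of_lt {m : ℕ} (μ : Fin m → ℕ) (k : ℕ) (hk : k ≤ m) (i : ℕ)
    (hi : i < ∑ j ∈ Finset.univ.filter (fun j : Fin m => (j : ℕ) < k), μ j) :
    ∃ a : Fin m, (a : ℕ) < k ∧ ∃ b < μ a, i = off μ a + b := by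
  induction k with
  | zero => simp at hi
  | succ k ih =>
    have h := sum_filter_lt_succ μ ⟨k, hk⟩
    by_cases hlt : i < off μ ⟨k, hk⟩
    · obtain ⟨a, ha, h⟩ := ih (by omega) hlt
      exact ⟨a, by omega, h⟩
    · exact ⟨⟨k, hk⟩, Nat.lt_succ_self k, i - off μ ⟨k, hk⟩, by simp only at h; omega, by omega⟩

theorem off_last_add {m : ℕ} (μ : Fin m → ℕ) (l : Fin m) (hl : (l : ℕ) + 1 = m) :
    off μ l + μ l = ∑ j, μ j := by
  rw [← sum_filter_lt_succ, Finset.filter_true_of_mem]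
  intro j _
  omega

theorem off_update_of_le {m : ℕ} (μ : Fin m → ℕ) (l a : Fin m) (x : ℕ) (h : a ≤ l) :
    off (Function.update μ l x) a = off μ a := by
  unfold off
  refine Finset.sum_congr rfl fun j hj => Function.update_of_ne ?_ _ _
  rintro rfl
  simp at hj
  exact absurd h (not_le.2 hj)

theorem stdVec_eq_single {n : ℕ} (j : Fin n) : stdVec n j = Pi.single j 1 := by
  ext i
  simp [stdVec, Pi.single_apply, Fin.ext_iff]

theorem mem_Lspan_of_support {m : ℕ} (μ : Fin m → ℕ) {n : ℕ} (x : Fin n → ℂ)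
    (h : ∀ i : Fin n, x i ≠ 0 → ∃ a : Fin m, (a : ℕ) + 1 < m ∧ (i : ℕ) = off μ a + (μ a - 1)) :
    x ∈ Lspan μ n := by
  rw [pi_eq_sum_univ' x]
  refine Submodule.sum_mem _ fun i _ => ?_
  by_cases hx : x i = 0
  · simp [hx]
  · obtain ⟨a, ha, hi⟩ := h i hx
    refine Submodule.smul_mem _ _ (Submodule.subset_span ⟨a, ha, ?_⟩)
    rw [← hi, stdVec_eq_single]

theorem range_le_Ssub {n : ℕ} (B : Matrix (Fin n) (Fin n) ℂ) {l : ℕ} (hl : 1 ≤ l) :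
    LinearMap.range B.mulVecLin ≤ Ssub B l := by
  rintro _ ⟨v, rfl⟩
  refine ⟨v, ?_⟩
  obtain ⟨l, rfl⟩ := Nat.exists_eq_add_of_le' hl
  simp [Matrix.mulVec_mulVec, pow_succ]

theorem ker_le_Ssub {n : ℕ} (B : Matrix (Fin n) (Fin n) ℂ) (l : ℕ) :
    LinearMap.ker (B ^ (l - 1)).mulVecLin ≤ Ssub B l := by
  intro v hv
  rw [LinearMap.mem_ker] at hv
  rw [Ssub, Submodule.mem_comap, hv]
  exact Submodule.zero_mem _

/-- The matrix of the inclusion of the first `d` coordinates. -/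
def inclMatrix (n d : ℕ) : Matrix (Fin n) (Fin d) ℂ := fun i j => if (i : ℕ) = j then 1 else 0

theorem inclMatrix_mulVec_apply {n d : ℕ} (v : Fin d → ℂ) (i : Fin n) :
    (inclMatrix n d).mulVec v i = if h : (i : ℕ) < d then v ⟨i, h⟩ else 0 := by
  simp only [Matrix.mulVec, dotProduct, inclMatrix, ite_mul, one_mul, zero_mul]
  split_ifs with h
  · rw [Finset.sum_eq_single ⟨i, h⟩]
    · simp
    · intro j _ hj
      rw [if_neg]
      intro hij
      exact hj (Fin.ext hij.symm)
    · simp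
  · refine Finset.sum_eq_zero fun j _ => if_neg (by omega)

theorem mul_inclMatrix {n d : ℕ} (hd : d ≤ n) (B : Matrix (Fin n) (Fin n) ℂ) (hB : upperTri B) :
    B * inclMatrix n d = inclMatrix n d * corner B d := by
  ext i j
  have hj : (j : ℕ) < n := by omega
  have h1 : (B * inclMatrix n d) i j = B i ⟨j, hj⟩ := by
    rw [Matrix.mul_apply, Finset.sum_eq_single ⟨j, hj⟩]
    · simp [inclMatrix]
    · intro k _ hk
      simp only [inclMatrix]
      rw [if_neg, mul_zero]
      intro h
      exact hk (Fin.ext h)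
    · simp
  have h2 : (inclMatrix n d * corner B d) i j
      = (inclMatrix n d).mulVec (fun k => corner B d k j) i := rfl
  rw [h1, h2, inclMatrix_mulVec_apply]
  split_ifs with h
  · simp [corner, ent, hj]
  · exact hB _ _ (by simp only; omega)

theorem pow_mul_inclMatrix {n d : ℕ} (hd : d ≤ n) (B : Matrix (Fin n) (Fin n) ℂ)
    (hB : upperTri B) (k : ℕ) :
    B ^ k * inclMatrix n d = inclMatrix n d * corner B d ^ k := by
  induction k with
  | zero => simp
  | succ k ih =>
    rw [pow_succ, Matrix.mul_assoc, mul_inclMatrix hd B hB, ← Matrix.mul_assoc, ih,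
      Matrix.mul_assoc, ← pow_succ]

/-- If a power of `B` and of a corner of `B` have the same rank, then the image of the power
is already attained on the coordinate subspace of the corner. -/
theorem exists_mulVec_inclMatrix_eq {n d : ℕ} (hd : d ≤ n) (B : Matrix (Fin n) (Fin n) ℂ)
    (hB : upperTri B) (k : ℕ) (hr : (corner B d ^ k).rank = (B ^ k).rank) (v : Fin n → ℂ) :
    ∃ u : Fin d → ℂ, (B ^ k).mulVec ((inclMatrix n d).mulVec u) = (B ^ k).mulVec v := by
  have hinj : Function.Injective (inclMatrix n d).mulVecLin := by
    intro x y hxy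
    ext j
    have := congrFun hxy ⟨j, by omega⟩
    simpa [inclMatrix_mulVec_apply] using this
  have hle : LinearMap.range (B ^ k * inclMatrix n d).mulVecLin
      ≤ LinearMap.range (B ^ k).mulVecLin := by
    rw [Matrix.mulVecLin_mul]
    exact LinearMap.range_comp_le_range _ _
  have heq := Submodule.eq_of_le_of_finrank_eq hle (by
    rw [pow_mul_inclMatrix hd B hB, Matrix.mulVecLin_mul, LinearMap.range_comp,
      ← (Submodule.equivMapOfInjective _ hinj _).finrank_eq]
    exact hr)
  obtain ⟨u, hu⟩ := heq.ge ⟨v, rfl⟩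
  exact ⟨u, by simpa [Matrix.mulVec_mulVec] using hu⟩

theorem hasType_of_corner {n d : ℕ} (B : Matrix (Fin n) (Fin n) ℂ) (h : d = n) {rows : ℕ}
    {κ : ℕ → ℕ} (hB : hasType (corner B d) rows κ) : hasType B rows κ := by
  subst h
  have : corner B d = B := by
    ext i j
    simp [corner, ent]
  rwa [this] at hB

/-- In the slice, every basis vector of a non-final block lies in `Im B + L`. -/
theorem single_mem_range_sup_Lspan {m n : ℕ} (μ : Fin m → ℕ) (l : Fin m) (hl : (l : ℕ) + 1 = m)
    (hn : n + 1 = ∑ j, μ j) (hμl : 1 ≤ μ l) (B : Matrix (Fin n) (Fin n) ℂ)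
    (hS : inSlice (Function.update μ l (μ l - 1)) B) (hU : upperTri B)
    (j : Fin n) (hj : (j : ℕ) < off μ l) :
    (Pi.single j 1 : Fin n → ℂ) ∈ LinearMap.range B.mulVecLin ⊔ Lspan μ n := by
  have htot := off_last_add μ l hl
  have hoff : ∀ a, off (Function.update μ l (μ l - 1)) a = off μ a := fun a =>
    off_update_of_le μ l a _ (Fin.le_def.2 (by omega))
  obtain ⟨a, ha, b, hb, hjab⟩ := exists_block_of_lt μ l l.2.le j hj
  have hμa : Function.update μ l (μ l - 1) a = μ a :=
    Function.update_of_ne (by rintro rfl; omega) _ _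
  by_cases hb1 : b + 1 = μ a
  · refine Submodule.mem_sup_right (Submodule.subset_span ⟨a, by omega, ?_⟩)
    rw [← stdVec_eq_single, hjab]
    congr 1
    omega
  have haoff : off μ a + μ a ≤ off μ l := by
    rw [← sum_filter_lt_succ]
    refine Finset.sum_le_sum_of_subset fun x hx => ?_
    simp at hx ⊢
    omega
  have hj1 : (j : ℕ) + 1 < n := by omega
  rw [← sub_sub_cancel (B.mulVec (Pi.single ⟨j + 1, hj1⟩ 1)) (Pi.single j 1)]
  refine Submodule.sub_mem _ (Submodule.mem_sup_left ⟨_, rfl⟩) (Submodule.mem_sup_right ?_)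
  refine mem_Lspan_of_support μ _ fun i hi => ?_
  simp only [Pi.sub_apply, Matrix.mulVec_single_one, Matrix.col_apply] at hi
  have hil : (i : ℕ) < off μ l := by
    by_contra h
    apply hi
    rw [hU _ _ (by simp only; omega), Pi.single_eq_of_ne, sub_zero]
    rintro rfl
    omega
  obtain ⟨s, hs, t, ht, hist⟩ := exists_block_of_lt μ l l.2.le i hil
  refine ⟨s, by omega, ?_⟩
  by_contra hne
  apply hi
  have hμs : Function.update μ l (μ l - 1) s = μ s :=
    Function.update_of_ne (by rintro rfl; omega) _ _
  have h := hS s a t (b + 1) (by omega) (by omega) (Or.inl (by omega))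
  rw [hoff, hoff, ← hist, ← add_assoc, ← hjab] at h
  have hent : ent B i (j + 1) = B i ⟨j + 1, hj1⟩ := by simp [ent, hj1]
  rw [← hent, h, sub_eq_zero, Pi.single_apply, Jent]
  refine if_congr ⟨?_, ?_⟩ rfl rfl
  · rintro ⟨_, _, _, h1, h2⟩
    exact Fin.ext (by omega)
  · rintro rfl
    exact ⟨a, b, by omega, by rw [hoff, hjab], by rw [hoff, hjab]⟩

/-- With `S = (B^{λ_r−1})^{-1}(Im B^{λ_r})` and
`L = span(e_1^{μ_1}, …, e_{m−1}^{μ_{m−1}})`, we have `ℂ^{N−1} = S + L`. -/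
theorem stmt6 (m : ℕ) (hm : 1 ≤ m) (μ : Fin m → ℕ)
    (hμmono : ∀ i j : Fin m, i ≤ j → μ j ≤ μ i) (hμpos : ∀ i : Fin m, 1 ≤ μ i)
    (N : ℕ) (hN : N = ∑ j, μ j)
    (lam : Fin m → ℕ) (hlammono : ∀ i j : Fin m, i ≤ j → lam j ≤ lam i)
    (hlamsum : ∑ j, lam j = N)
    (T : Tableau m lam μ)
    (r : ℕ) (hr1 : 1 ≤ r) (hrm : r ≤ m)
    (hrow : shapeRowBox T m (μ ⟨m - 1, by omega⟩ - 1) (r - 1) + 1 = ext lam (r - 1))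
    (hother : ∀ s : ℕ, s ≠ r - 1 →
      shapeRowBox T m (μ ⟨m - 1, by omega⟩ - 1) s = ext lam s)
    (B : Matrix (Fin (N - 1)) (Fin (N - 1)) ℂ)
    (hB : B ∈ XcircMinus μ lam N T ⟨m - 1, by omega⟩) :
    Ssub B (ext lam (r - 1)) ⊔ Lspan μ (N - 1) = ⊤ := by
  obtain ⟨hS, hU, hT⟩ := hB
  set l : Fin m := ⟨m - 1, by omega⟩ with hldef
  have hl : (l : ℕ) + 1 = m := by simp only [hldef]; omega
  have hμl := hμpos l
  have htot := off_last_add μ l hl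
  obtain ⟨hk, hshape⟩ := shapeRow_tsub_eq_shapeRowBox_tsub T _ _ hrow hother
  have hmem : ∀ v : Fin (N - 1) → ℂ, (∀ i, v i ≠ 0 → (i : ℕ) < off μ l) →
      v ∈ Ssub B (ext lam (r - 1)) ⊔ Lspan μ (N - 1) := by
    intro v hv
    rw [pi_eq_sum_univ' v]
    refine Submodule.sum_mem _ fun i _ => ?_
    by_cases hi : v i = 0
    · simp [hi]
    refine Submodule.smul_mem _ _ ?_
    exact sup_le_sup_right (range_le_Ssub B (by omega)) _
      (single_mem_range_sup_Lspan μ l hl (by omega) hμl B hS hU i (hv i hi))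
  rw [eq_top_iff]
  intro v _
  by_cases hone : μ l = 1
  · exact hmem v fun i _ => by omega
  have hBtype : hasType B m (shapeRowBox T m (μ l - 1)) := by
    have := hT l
    rw [if_pos hl] at this
    refine hasType_of_corner B ?_ this
    rw [off_update_of_le _ _ _ _ le_rfl, Function.update_self]
    omega
  have hCtype : hasType (corner B (off μ l)) m (shapeRow T (m - 1)) := by
    rcases Nat.lt_or_ge 1 m with h1 | h1
    · have h2 := hT ⟨m - 2, by omega⟩
      rw [if_neg (by simp only; omega),
        off_update_of_le _ _ _ _ (Fin.le_def.2 (by simp only; omega)),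
        Function.update_of_ne (by rw [Ne, Fin.ext_iff]; simp only; omega),
        ← sum_filter_lt_succ] at h2
      have h3 : m - 2 + 1 = m - 1 := by omega
      have h4 : off μ l = ∑ j ∈ Finset.univ.filter (fun j : Fin m => (j : ℕ) < m - 2 + 1), μ j :=
        Finset.sum_congr (Finset.filter_congr fun j _ => by simp only [hldef, h3]) fun _ _ => rfl
      rw [← h4] at h2
      simpa only [h3] using h2
    · intro k _
      have h0 : off μ l = 0 := by
        refine Finset.sum_eq_zero fun j hj => ?_
        simp at hj
        omega
      have h2 : (corner B (off μ l) ^ k).rank ≤ 0 :=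
        (Matrix.rank_le_card_width _).trans (by simp [h0])
      have h3 : ∀ s, shapeRow T (m - 1) s = 0 := fun s =>
        Finset.card_eq_zero.2 (Finset.filter_false_of_mem fun c _ => by omega)
      simp only [h3, Nat.zero_sub, Finset.sum_const_zero]
      omega
  have hrank : (corner B (off μ l) ^ (ext lam (r - 1) - 1)).rank
      = (B ^ (ext lam (r - 1) - 1)).rank := by
    rw [hCtype _ (by omega), hBtype _ (by omega)]
    exact Finset.sum_congr rfl fun s _ => hshape s
  obtain ⟨u, hu⟩ := exists_mulVec_inclMatrix_eq (by omega) B hU _ hrank v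
  rw [← sub_add_cancel v ((inclMatrix (N - 1) (off μ l)).mulVec u)]
  refine Submodule.add_mem _ (Submodule.mem_sup_left (ker_le_Ssub B _ ?_)) (hmem _ ?_)
  · simp [Matrix.mulVec_sub, hu]
  · intro i hi
    by_contra h
    exact hi (by rw [inclMatrix_mulVec_apply, dif_neg h])

end Gov
end
end
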